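/- arXiv:2507.18499 — 9 statements merged into one kernel-verified Lean document; each statement's English description precedes it below -/
import Mathlib

section
/- For every rational number x there exist a unique integer n and a unique finite set F of triples (p, k, r) of integers — with each p prime, each k ≥ 1, each r satisfying 1 ≤ r ≤ p − 1, and the pairs (p, k) occurring in F pairwise distinct — such that x = n + ∑_{(p,k,r) ∈ F} r / p^k. -/
/-- The conditions on the finite set of triples `(p, k, r)` in a partial fraction expansion. -/
def IsPartialFractionSet (F : Finset (ℤ × ℤ × ℤ)) : Prop :=
  (∀ t ∈ F, Prime t.1 ∧ 1 ≤ t.2.1 ∧ 1 ≤ t.2.2 ∧ t.2.2 ≤ t.1 - 1) ∧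
    ∀ t ∈ F, ∀ t' ∈ F, t.1 = t'.1 → t.2.1 = t'.2.1 → t = t'

/-- The sum of the numerators of the triples in `F` lying over a given pair `(p, k)`. -/
def partialFractionCoeff (F : Finset (ℤ × ℤ × ℤ)) (i : ℤ × ℤ) : ℤ :=
  ∑ t ∈ F with (t.1, t.2.1) = i, t.2.2

theorem exists_isPartialFractionSet (D : ℕ) (hD : D ≠ 0) (a : ℤ) :
    ∃ (n : ℤ) (F : Finset (ℤ × ℤ × ℤ)), IsPartialFractionSet F ∧
      (∀ t ∈ F, t.1 ^ t.2.1.toNat ∣ (D : ℤ)) ∧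
      (a : ℚ) / D = n + ∑ t ∈ F, (t.2.2 : ℚ) / (t.1 : ℚ) ^ t.2.1 := by
  induction D using Nat.strong_induction_on generalizing a with
  | _ D ih =>
  by_cases hD1 : D = 1
  · exact ⟨a, ∅, by simp [IsPartialFractionSet], by simp, by simp [hD1]⟩
  obtain ⟨p, hp, hpD⟩ := Nat.exists_prime_and_dvd hD1
  obtain ⟨k, m, hpm, hDm⟩ := Nat.exists_eq_pow_mul_and_not_dvd hD p hp.ne_one
  obtain _ | k := k
  · simp only [pow_zero, one_mul] at hDm
    exact absurd (hDm ▸ hpD) hpm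
  have hm : m ≠ 0 := by rintro rfl; simp at hpm
  have hp0 : (p : ℤ) ≠ 0 := by exact_mod_cast hp.ne_zero
  have hcop : IsCoprime (m : ℤ) (p : ℤ) :=
    Nat.isCoprime_iff_coprime.2 ((Nat.Prime.coprime_iff_not_dvd hp).2 hpm).symm
  obtain ⟨u, v, huv⟩ := hcop
  obtain ⟨r, hr0, hrp, b, hb⟩ : ∃ r : ℤ, 0 ≤ r ∧ r < p ∧ ∃ b, a - r * m = p * b := by
    refine ⟨a * u % p, Int.emod_nonneg _ hp0, Int.emod_lt_of_pos _ (by exact_mod_cast hp.pos),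
      a * v + m * (a * u / p), ?_⟩
    linear_combination (-a) * huv - m * Int.mul_ediv_add_emod (a * u) p
  have hlt : p ^ k * m < D := by
    rw [hDm, pow_succ]
    have : 0 < p ^ k * m := by have := hp.pos; positivity
    nlinarith [hp.two_le]
  have hne : p ^ k * m ≠ 0 := mul_ne_zero (pow_ne_zero _ hp.ne_zero) hm
  have hdvd : ((p ^ k * m : ℕ) : ℤ) ∣ (D : ℤ) := by
    refine Int.natCast_dvd_natCast.2 ⟨p, ?_⟩
    rw [hDm]; ring
  obtain ⟨n, F, hF, hFD, hsum⟩ := ih _ hlt hne b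
  have hab : (a : ℚ) / D = r / (p : ℚ) ^ (k + 1) + b / (p ^ k * m : ℕ) := by
    have hpq : (p : ℚ) ≠ 0 := by exact_mod_cast hp.ne_zero
    have hmq : (m : ℚ) ≠ 0 := by exact_mod_cast hm
    have hbq : (a : ℚ) - r * m = p * b := by exact_mod_cast hb
    rw [hDm]
    push_cast
    field_simp
    linear_combination (p : ℚ) ^ k * hbq
  obtain rfl | hrpos := hr0.eq_or_lt
  · refine ⟨n, F, hF, fun t ht => (hFD t ht).trans hdvd, ?_⟩
    rw [hab, ← hsum]; simp
  have hnew : ∀ t ∈ F, ¬ (t.1 = p ∧ t.2.1 = ((k + 1 : ℕ) : ℤ)) := by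
    rintro t ht ⟨h1, h2⟩
    have h := hFD t ht
    rw [h1, h2, Int.toNat_natCast] at h
    have h' : p ^ (k + 1) ∣ p ^ k * m := by exact_mod_cast h
    rw [pow_succ] at h'
    exact hpm (Nat.dvd_of_mul_dvd_mul_left (pow_pos hp.pos k) h')
  refine ⟨n, insert ((p : ℤ), ((k + 1 : ℕ) : ℤ), r) F, ⟨?_, ?_⟩, ?_, ?_⟩
  · intro t ht
    obtain rfl | ht := Finset.mem_insert.1 ht
    · exact ⟨Nat.prime_iff_prime_int.1 hp, by simp, hrpos, by simp only; omega⟩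
    · exact hF.1 t ht
  · intro t ht t' ht' h1 h2
    obtain rfl | ht := Finset.mem_insert.1 ht <;> obtain rfl | ht' := Finset.mem_insert.1 ht'
    · rfl
    · exact absurd ⟨h1.symm, h2.symm⟩ (hnew t' ht')
    · exact absurd ⟨h1, h2⟩ (hnew t ht)
    · exact hF.2 t ht t' ht' h1 h2
  · intro t ht
    obtain rfl | ht := Finset.mem_insert.1 ht
    · rw [Int.toNat_natCast, hDm]
      push_cast
      exact Dvd.intro _ rfl
    · exact (hFD t ht).trans hdvd
  · rw [Finset.sum_insert fun h => hnew _ h ⟨rfl, rfl⟩, hab, hsum, zpow_natCast]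
    push_cast
    ring

theorem padicNorm_prime_zpow_of_ne {p q : ℕ} [Fact p.Prime] (hq : q.Prime) (h : p ≠ q) (k : ℤ) :
    padicNorm p ((q : ℚ) ^ k) = 1 := by
  have : Fact q.Prime := ⟨hq⟩
  have hq1 : padicNorm p (q : ℚ) = 1 := padicNorm.padicNorm_of_prime_of_ne h
  rw [show padicNorm p ((q : ℚ) ^ k) = padicNorm p (q : ℚ) ^ k from
    map_zpow₀ (IsAbsoluteValue.toAbsoluteValue (padicNorm p)) _ _, hq1, one_zpow]

theorem padicNorm_div_prime_zpow {p : ℕ} [Fact p.Prime] (d k : ℤ) :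
    padicNorm p ((d : ℚ) / (p : ℚ) ^ k) = padicNorm p d * (p : ℚ) ^ k := by
  have hp : p.Prime := Fact.out
  rw [padicNorm.div, show padicNorm p ((p : ℚ) ^ k) = padicNorm p (p : ℚ) ^ k from
    map_zpow₀ (IsAbsoluteValue.toAbsoluteValue (padicNorm p)) _ _,
    padicNorm.padicNorm_p hp.one_lt, inv_zpow, div_inv_eq_mul]

theorem eq_zero_of_sum_div_prime_zpow_eq_int {P : Finset (ℤ × ℤ)} {d : ℤ × ℤ → ℤ} {m : ℤ}
    (hP : ∀ i ∈ P, Prime i.1 ∧ 1 ≤ i.2) (hd : ∀ i ∈ P, |d i| < i.1)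
    (hsum : ∑ i ∈ P, (d i : ℚ) / (i.1 : ℚ) ^ i.2 = m) : ∀ i ∈ P, d i = 0 := by
  have hnat : ∀ i ∈ P, ∃ q : ℕ, q.Prime ∧ i.1 = q := fun i hi => by
    refine ⟨i.1.natAbs, Int.prime_iff_natAbs_prime.1 (hP i hi).1, ?_⟩
    have := (abs_nonneg _).trans_lt (hd i hi)
    omega
  by_contra! hex
  obtain ⟨i₀, hi₀, hdi₀⟩ := hex
  obtain ⟨i, hi, hmax⟩ := Finset.exists_max_image {j ∈ P | j.1 = i₀.1 ∧ d j ≠ 0} Prod.snd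
    ⟨i₀, by simp [hi₀, hdi₀]⟩
  simp only [Finset.mem_filter] at hi hmax
  obtain ⟨hiP, hi1, hdi⟩ := hi
  obtain ⟨p, hp, hip⟩ := hnat i hiP
  have : Fact p.Prime := ⟨hp⟩
  have hp1 : (1 : ℚ) < p := by exact_mod_cast hp.one_lt
  have hk := (hP i hiP).2
  have hbig : padicNorm p ((d i : ℚ) / (i.1 : ℚ) ^ i.2) = (p : ℚ) ^ i.2 := by
    have hnd : ¬ (p : ℤ) ∣ d i := fun h =>
      hdi (Int.eq_zero_of_abs_lt_dvd h (hip ▸ hd i hiP))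
    rw [hip, Int.cast_natCast, padicNorm_div_prime_zpow,
      (padicNorm.int_eq_one_iff (d i)).2 hnd, one_mul]
  have hone : (1 : ℚ) ≤ (p : ℚ) ^ (i.2 - 1) := one_le_zpow₀ hp1.le (by omega)
  have hsmall : ∀ j ∈ P.erase i,
      padicNorm p ((d j : ℚ) / (j.1 : ℚ) ^ j.2) ≤ (p : ℚ) ^ (i.2 - 1) := by
    intro j hj
    obtain ⟨hji, hjP⟩ := Finset.mem_erase.1 hj
    obtain ⟨q, hq, hjq⟩ := hnat j hjP
    by_cases hdj : d j = 0
    · simp only [hdj, Int.cast_zero, zero_div, padicNorm.zero]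
      positivity
    by_cases hpq : p = q
    · subst hpq
      have hle := hmax j ⟨hjP, by rw [hjq, ← hip, hi1], hdj⟩
      have hne : j.2 ≠ i.2 := fun h => hji (Prod.ext (hjq.trans hip.symm) h)
      rw [hjq, Int.cast_natCast, padicNorm_div_prime_zpow]
      calc padicNorm p (d j) * (p : ℚ) ^ j.2 ≤ 1 * (p : ℚ) ^ j.2 := by
            gcongr; exact padicNorm.of_int _
        _ ≤ (p : ℚ) ^ (i.2 - 1) := by
            rw [one_mul]; exact zpow_le_zpow_right₀ hp1.le (by omega)
    · rw [hjq, Int.cast_natCast, padicNorm.div, padicNorm_prime_zpow_of_ne hq hpq, div_one]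
      exact (padicNorm.of_int _).trans hone
  have hrest : padicNorm p (∑ j ∈ P.erase i, (d j : ℚ) / (j.1 : ℚ) ^ j.2) ≤
      (p : ℚ) ^ (i.2 - 1) := padicNorm.sum_le' hsmall (by positivity)
  have heq : (d i : ℚ) / (i.1 : ℚ) ^ i.2 =
      m - ∑ j ∈ P.erase i, (d j : ℚ) / (j.1 : ℚ) ^ j.2 := by
    rw [← hsum, ← Finset.add_sum_erase P _ hiP]; ring
  have hle : (p : ℚ) ^ i.2 ≤ (p : ℚ) ^ (i.2 - 1) := by
    rw [← hbig, heq]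
    exact padicNorm.sub.trans (max_le ((padicNorm.of_int m).trans hone) hrest)
  exact absurd hle (not_le.2 (zpow_lt_zpow_right₀ hp1 (by omega)))

namespace IsPartialFractionSet

variable {F F' : Finset (ℤ × ℤ × ℤ)}

theorem coeff_eq (hF : IsPartialFractionSet F) {t : ℤ × ℤ × ℤ} (ht : t ∈ F) :
    partialFractionCoeff F (t.1, t.2.1) = t.2.2 := by
  have : {s ∈ F | (s.1, s.2.1) = (t.1, t.2.1)} = {t} := by
    ext s
    simp only [Finset.mem_filter, Finset.mem_singleton, Prod.mk.injEq]
    exact ⟨fun h => hF.2 s h.1 t ht h.2.1 h.2.2, by rintro rfl; exact ⟨ht, rfl, rfl⟩⟩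
  rw [partialFractionCoeff, this, Finset.sum_singleton]

theorem exists_mem_of_coeff_ne_zero {i : ℤ × ℤ} (h : partialFractionCoeff F i ≠ 0) :
    ∃ t ∈ F, (t.1, t.2.1) = i := by
  obtain ⟨t, ht, -⟩ := Finset.exists_ne_zero_of_sum_ne_zero h
  exact ⟨t, Finset.mem_filter.1 ht⟩

theorem coeff_mem_Ico (hF : IsPartialFractionSet F) {i : ℤ × ℤ} (hi : 0 < i.1) :
    0 ≤ partialFractionCoeff F i ∧ partialFractionCoeff F i < i.1 := by
  by_cases h : partialFractionCoeff F i = 0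
  · exact ⟨h.ge, h ▸ hi⟩
  · obtain ⟨t, ht, rfl⟩ := exists_mem_of_coeff_ne_zero h
    rw [hF.coeff_eq ht]
    have := hF.1 t ht
    constructor <;> omega

theorem sum_eq_sum_coeff {P : Finset (ℤ × ℤ)} (hP : ∀ t ∈ F, (t.1, t.2.1) ∈ P) :
    ∑ t ∈ F, (t.2.2 : ℚ) / (t.1 : ℚ) ^ t.2.1 =
      ∑ i ∈ P, (partialFractionCoeff F i : ℚ) / (i.1 : ℚ) ^ i.2 := by
  rw [← Finset.sum_fiberwise_of_maps_to hP]
  refine Finset.sum_congr rfl fun i _ => ?_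
  rw [partialFractionCoeff, Int.cast_sum, Finset.sum_div]
  refine Finset.sum_congr rfl fun t ht => ?_
  rw [← (Finset.mem_filter.1 ht).2]

theorem subset_of_coeff_eq (hF : IsPartialFractionSet F) (hF' : IsPartialFractionSet F')
    (h : ∀ t ∈ F, partialFractionCoeff F (t.1, t.2.1) = partialFractionCoeff F' (t.1, t.2.1)) :
    F ⊆ F' := by
  intro t ht
  have hc := h t ht
  rw [hF.coeff_eq ht] at hc
  obtain ⟨t', ht', heq⟩ := exists_mem_of_coeff_ne_zero (F := F') (i := (t.1, t.2.1)) (by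
    have := (hF.1 t ht).2.2.1
    omega)
  rw [← heq, hF'.coeff_eq ht'] at hc
  obtain ⟨h1, h2⟩ := Prod.mk.inj heq
  rwa [show t = t' from Prod.ext h1.symm (Prod.ext h2.symm hc)]

theorem eq_of_sum_eq (hF : IsPartialFractionSet F) (hF' : IsPartialFractionSet F') {n n' : ℤ}
    (h : (n : ℚ) + ∑ t ∈ F, (t.2.2 : ℚ) / (t.1 : ℚ) ^ t.2.1 =
      n' + ∑ t ∈ F', (t.2.2 : ℚ) / (t.1 : ℚ) ^ t.2.1) : F = F' := by
  classical
  set P : Finset (ℤ × ℤ) := (F ∪ F').image fun t => (t.1, t.2.1)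
  have hFP : ∀ t ∈ F, (t.1, t.2.1) ∈ P := fun t ht =>
    Finset.mem_image_of_mem (fun t : ℤ × ℤ × ℤ => (t.1, t.2.1)) (Finset.mem_union_left _ ht)
  have hFP' : ∀ t ∈ F', (t.1, t.2.1) ∈ P := fun t ht =>
    Finset.mem_image_of_mem (fun t : ℤ × ℤ × ℤ => (t.1, t.2.1)) (Finset.mem_union_right _ ht)
  have hP : ∀ i ∈ P, (Prime i.1 ∧ 1 ≤ i.2) ∧ 0 < i.1 := by
    intro i hi
    obtain ⟨t, ht, rfl⟩ := Finset.mem_image.1 hi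
    have := (Finset.mem_union.1 ht).elim (hF.1 t) (hF'.1 t)
    exact ⟨⟨this.1, this.2.1⟩, by omega⟩
  have hzero := eq_zero_of_sum_div_prime_zpow_eq_int (P := P) (m := n' - n)
    (d := fun i => partialFractionCoeff F i - partialFractionCoeff F' i)
    (fun i hi => (hP i hi).1)
    (fun i hi => by
      have h1 := hF.coeff_mem_Ico (hP i hi).2
      have h2 := hF'.coeff_mem_Ico (hP i hi).2
      rw [abs_lt]
      constructor <;> omega)
    (by
      rw [sum_eq_sum_coeff hFP, sum_eq_sum_coeff hFP'] at h
      push_cast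
      simp only [sub_div, Finset.sum_sub_distrib]
      linear_combination h)
  exact (hF.subset_of_coeff_eq hF' fun t ht => sub_eq_zero.1 (hzero _ (hFP t ht))).antisymm
    (hF'.subset_of_coeff_eq hF fun t ht => (sub_eq_zero.1 (hzero _ (hFP' t ht))).symm)

end IsPartialFractionSet

/-- **Partial fractions in ℚ.**  Every rational number `x` has a unique representation
`x = n + ∑_{(p,k,r) ∈ F} r / p^k`, where `n` is an integer and `F` is a finite set of
integer triples `(p, k, r)` with each `p` prime, each `k ≥ 1`, each `1 ≤ r ≤ p - 1`,
and the pairs `(p, k)` occurring in `F` pairwise distinct. -/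
theorem partial_fractions_in_rationals (x : ℚ) :
    ∃! nF : ℤ × Finset (ℤ × ℤ × ℤ),
      (∀ t ∈ nF.2, Prime t.1 ∧ 1 ≤ t.2.1 ∧ 1 ≤ t.2.2 ∧ t.2.2 ≤ t.1 - 1) ∧
      (∀ t ∈ nF.2, ∀ t' ∈ nF.2, t.1 = t'.1 → t.2.1 = t'.2.1 → t = t') ∧
      x = (nF.1 : ℚ) + ∑ t ∈ nF.2, (t.2.2 : ℚ) / (t.1 : ℚ) ^ t.2.1 := by
  obtain ⟨n, F, hF, -, hsum⟩ := exists_isPartialFractionSet x.den x.den_nz x.num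
  rw [Rat.num_div_den] at hsum
  refine ⟨(n, F), ⟨hF.1, hF.2, hsum⟩, ?_⟩
  rintro ⟨n', F'⟩ ⟨h1, h2, hsum'⟩
  have hFF : F' = F := IsPartialFractionSet.eq_of_sum_eq ⟨h1, h2⟩ hF (hsum'.symm.trans hsum)
  subst hFF
  have hnn : (n' : ℚ) = n := add_right_cancel (hsum'.symm.trans hsum)
  rw [Int.cast_injective hnn]
end

section
/- Let b₁, …, b_ℓ be pairwise coprime positive integers with product b. Then the map sending a pair (n, (a₁, …, a_ℓ)), where n ∈ ℤ and each a_j satisfies 0 ≤ a_j < b_j and gcd(a_j, b_j) = 1, to the rational number n + ∑_{j=1}^{ℓ} a_j / b_j is a bijection onto the set of rationals of the form m/b with gcd(m, b) = 1. -/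
open Finset in
/-- The product of all `b i` with `i ≠ j`. -/
def cofactor {ι : Type*} [Fintype ι] [DecidableEq ι] (b : ι → ℤ) (j : ι) : ℤ :=
  ∏ i ∈ univ.erase j, b i

section cofactor

variable {ι : Type*} [Fintype ι] [DecidableEq ι] {b : ι → ℤ}

lemma mul_cofactor (b : ι → ℤ) (j : ι) : b j * cofactor b j = ∏ i, b i :=
  Finset.mul_prod_erase _ _ (Finset.mem_univ j)

lemma dvd_cofactor {i j : ι} (h : i ≠ j) : b i ∣ cofactor b j :=
  Finset.dvd_prod_of_mem _ (by simp [h])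

lemma isCoprime_cofactor (hb : Pairwise fun i j => IsCoprime (b i) (b j)) (j : ι) :
    IsCoprime (cofactor b j) (b j) :=
  IsCoprime.prod_left fun _ hi => hb (Finset.ne_of_mem_erase hi)

/-- Modulo `b i`, the numerator of `n + ∑ j, a j / b j` over the common denominator is
`a i * cofactor b i`. -/
lemma dvd_numerator_sub (n : ℤ) (a : ι → ℤ) (i : ι) :
    b i ∣ (n * ∏ j, b j + ∑ j, a j * cofactor b j) - a i * cofactor b i := by
  rw [← Finset.add_sum_erase _ _ (Finset.mem_univ i), ← mul_cofactor b i]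
  have h : b i ∣ ∑ j ∈ Finset.univ.erase i, a j * cofactor b j :=
    Finset.dvd_sum fun j hj => (dvd_cofactor (Finset.ne_of_mem_erase hj).symm).mul_left _
  obtain ⟨k, hk⟩ := h
  refine ⟨n * cofactor b i + k, ?_⟩
  rw [hk]
  ring

lemma add_sum_div_eq (hb : ∀ j, b j ≠ 0) (n : ℤ) (a : ι → ℤ) :
    (n : ℚ) + ∑ j, (a j : ℚ) / (b j : ℚ) =
      ((n * ∏ j, b j + ∑ j, a j * cofactor b j : ℤ) : ℚ) / ((∏ j, b j : ℤ) : ℚ) := by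
  have hB : ((∏ j, b j : ℤ) : ℚ) ≠ 0 := by
    exact_mod_cast Finset.prod_ne_zero_iff.2 fun j _ => hb j
  rw [eq_div_iff hB, add_mul, Finset.sum_mul, Int.cast_add, Int.cast_mul, Int.cast_sum]
  congr 1
  refine Finset.sum_congr rfl fun j _ => ?_
  have hj : (b j : ℚ) ≠ 0 := by exact_mod_cast hb j
  rw [← mul_cofactor b j]
  push_cast
  field_simp

end cofactor

lemma isCoprime_iff_of_dvd_sub {x y d : ℤ} (h : d ∣ x - y) : IsCoprime x d ↔ IsCoprime y d := by
  obtain ⟨k, hk⟩ := h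
  rw [show x = y + d * k by linarith, IsCoprime.add_mul_left_left_iff]

/-- **Chinese-remainder bijection for reduced partial fractions.**  Let `b 0, …, b (ℓ-1)`
be pairwise coprime positive integers with product `B`.  Then the map sending a pair
`(n, a)`, where `n ∈ ℤ` and each `a j` satisfies `0 ≤ a j < b j` and `gcd(a j, b j) = 1`,
to the rational number `n + ∑ j, a j / b j` is a bijection onto the set of rationals of
the form `m / B` with `gcd(m, B) = 1`. -/
theorem chinese_remainder_reduced_partial_fraction_bijection
    (ℓ : ℕ) (b : Fin ℓ → ℕ) (hb : ∀ j, 0 < b j)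
    (hcop : ∀ i j, i ≠ j → Nat.Coprime (b i) (b j))
    (B : ℕ) (hB : B = ∏ j, b j) :
    Set.BijOn
      (fun na : ℤ × (Fin ℓ → ℤ) => (na.1 : ℚ) + ∑ j, (na.2 j : ℚ) / (b j : ℚ))
      {na : ℤ × (Fin ℓ → ℤ) |
        ∀ j, 0 ≤ na.2 j ∧ na.2 j < (b j : ℤ) ∧ Int.gcd (na.2 j) (b j : ℤ) = 1}
      {x : ℚ | ∃ m : ℤ, Int.gcd m (B : ℤ) = 1 ∧ x = (m : ℚ) / (B : ℚ)} := by
  set β : Fin ℓ → ℤ := fun j => b j with hβ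
  have hβ0 : ∀ j, β j ≠ 0 := fun j => by simpa [hβ] using (hb j).ne'
  have hβcop : Pairwise fun i j => IsCoprime (β i) (β j) := fun i j hij =>
    Nat.isCoprime_iff_coprime.2 (hcop i j hij)
  have hBβ : (B : ℤ) = ∏ j, β j := by simp [hB, hβ]
  have hB0 : (∏ j, β j) ≠ 0 := Finset.prod_ne_zero_iff.2 fun j _ => hβ0 j
  have hBQ : ((∏ j, β j : ℤ) : ℚ) ≠ 0 := by exact_mod_cast hB0
  have hBcast : (B : ℚ) = ((∏ j, β j : ℤ) : ℚ) := by rw [← hBβ]; simp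
  have hval : ∀ (n : ℤ) (a : Fin ℓ → ℤ), (n : ℚ) + ∑ j, (a j : ℚ) / (b j : ℚ) =
      ((n * ∏ j, β j + ∑ j, a j * cofactor β j : ℤ) : ℚ) / ((∏ j, β j : ℤ) : ℚ) :=
    fun n a => by simpa [hβ] using add_sum_div_eq hβ0 n a
  refine ⟨?_, ?_, ?_⟩
  · rintro ⟨n, a⟩ ha
    refine ⟨n * ∏ j, β j + ∑ j, a j * cofactor β j, ?_, by rw [hBcast]; exact hval n a⟩
    rw [← Int.isCoprime_iff_gcd_eq_one, hBβ]
    refine IsCoprime.prod_right fun i _ => ?_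
    rw [isCoprime_iff_of_dvd_sub (dvd_numerator_sub n a i)]
    exact (Int.isCoprime_iff_gcd_eq_one.2 (ha i).2.2).mul_left (isCoprime_cofactor hβcop i)
  · rintro ⟨n, a⟩ ha ⟨n', a'⟩ ha' h
    simp only [hval] at h
    have hN : n * ∏ j, β j + ∑ j, a j * cofactor β j =
        n' * ∏ j, β j + ∑ j, a' j * cofactor β j := by
      exact_mod_cast (div_left_inj' hBQ).1 h
    have haa : a = a' := by
      funext i
      have h1 := dvd_numerator_sub (b := β) n a i
      rw [hN] at h1
      have h2 := dvd_sub (dvd_numerator_sub (b := β) n' a' i) h1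
      rw [sub_sub_sub_cancel_left, ← sub_mul] at h2
      have h3 : β i ∣ a i - a' i := (isCoprime_cofactor hβcop i).symm.dvd_of_dvd_mul_right h2
      have h4 := Int.emod_eq_emod_iff_emod_sub_eq_zero.2 (Int.emod_eq_zero_of_dvd h3)
      rwa [Int.emod_eq_of_lt (ha i).1 (ha i).2.1,
        Int.emod_eq_of_lt (ha' i).1 (ha' i).2.1] at h4
    subst haa
    rw [Prod.mk.injEq]
    exact ⟨mul_right_cancel₀ hB0 (add_right_cancel hN), rfl⟩
  · rintro x ⟨m, hm, rfl⟩
    rw [← Int.isCoprime_iff_gcd_eq_one, hBβ] at hm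
    choose u v huv using isCoprime_cofactor hβcop
    set a : Fin ℓ → ℤ := fun i => m * u i % β i with ha
    have hmod : ∀ i, β i ∣ m - a i * cofactor β i := fun i => by
      refine ⟨m * v i + m * u i / β i * cofactor β i, ?_⟩
      have h1 : a i = m * u i - β i * (m * u i / β i) := Int.emod_def _ _
      rw [h1]
      linear_combination (-m) * huv i
    have hdvd : ∏ j, β j ∣ m - ∑ j, a j * cofactor β j :=
      Finset.prod_dvd_of_coprime (hβcop.set_pairwise _) fun i _ => by
        have h1 := dvd_sub (hmod i) (dvd_numerator_sub (b := β) 0 a i)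
        simpa using h1
    obtain ⟨n, hn⟩ := hdvd
    refine ⟨(n, a), fun i => ⟨Int.emod_nonneg _ (hβ0 i), ?_, ?_⟩, ?_⟩
    · exact Int.emod_lt_of_pos _ (Int.natCast_pos.2 (hb i))
    · rw [← Int.isCoprime_iff_gcd_eq_one]
      have h1 : IsCoprime m (β i) :=
        hm.of_isCoprime_of_dvd_right (Finset.dvd_prod_of_mem _ (Finset.mem_univ i))
      exact ((isCoprime_iff_of_dvd_sub (hmod i)).1 h1).of_mul_left_left
    · simp only [hval, hBcast]
      congr 2
      linear_combination -hn
end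

section
/- Let G be a finitely generated group that contains an abelian subgroup of finite index. Then G contains a normal subgroup K of finite index such that K is free abelian of finite rank, i.e. K is isomorphic as a group to ℤ^k for some k ≥ 0. -/
/-- A finitely generated torsion-free abelian group is free abelian of finite rank. -/
theorem CommGroup.exists_mulEquiv_multiplicative_pi_int (H : Type*) [CommGroup H] [Group.FG H]
    [IsMulTorsionFree H] : ∃ k : ℕ, Nonempty (H ≃* Multiplicative (Fin k → ℤ)) := by
  have : Module.Finite ℤ (Additive H) := Module.Finite.iff_addGroup_fg.mpr inferInstance
  obtain ⟨k, b⟩ := Module.basisOfFiniteTypeTorsionFree' (R := ℤ) (M := Additive H)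
  exact ⟨k, ⟨b.equivFun.toAddEquiv.toMultiplicativeRight⟩⟩

/-- A finitely generated abelian group has a torsion-free subgroup of finite index. -/
theorem CommGroup.exists_finiteIndex_isMulTorsionFree (H : Type*) [CommGroup H] [Group.FG H] :
    ∃ N : Subgroup H, N.FiniteIndex ∧ IsMulTorsionFree N := by
  obtain ⟨ι, j, _, _, p, hp, e, ⟨φ⟩⟩ := CommGroup.equiv_free_prod_prod_multiplicative_zmod H
  have (i : ι) : NeZero (p i ^ e i) := ⟨pow_ne_zero _ (hp i).ne_zero⟩
  have (i : ι) : Finite (Multiplicative (ZMod (p i ^ e i))) :=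
    inferInstanceAs (Finite (ZMod (p i ^ e i)))
  let π := (MonoidHom.snd _ _).comp φ.toMonoidHom
  let ψ := ((MonoidHom.fst _ _).comp φ.toMonoidHom).comp π.ker.subtype
  have hψ : Function.Injective ψ := fun x y hxy ↦
    Subtype.ext <| φ.injective <| Prod.ext hxy <| x.2.trans y.2.symm
  exact ⟨π.ker, inferInstance, hψ.isMulTorsionFree ψ⟩

/-- A finitely generated virtually abelian group has a finite-index normal subgroup
which is free abelian of finite rank. -/
theorem virtually_abelian_has_free_abelian_normal_finite_index
    (G : Type*) [Group G] (hfg : Group.FG G)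
    (A : Subgroup G) (hA : ∀ x y : A, x * y = y * x) (hAidx : A.FiniteIndex) :
    ∃ K : Subgroup G, K.Normal ∧ K.FiniteIndex ∧
      ∃ k : ℕ, Nonempty (K ≃* Multiplicative (Fin k → ℤ)) := by
  let _ : CommGroup A := { mul_comm := hA }
  have : Group.FG A := A.fg_of_index_ne_zero
  obtain ⟨N, hN, hNtf⟩ := CommGroup.exists_finiteIndex_isMulTorsionFree A
  let L := N.map A.subtype
  have : L.FiniteIndex := ⟨by
    rw [Subgroup.index_map_subtype]
    exact mul_ne_zero hN.index_ne_zero hAidx.index_ne_zero⟩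
  have hKL : L.normalCore ≤ L := L.normalCore_le
  have hKA : L.normalCore ≤ A := hKL.trans (Subgroup.map_subtype_le N)
  let _ : CommGroup L.normalCore :=
    { mul_comm := fun x y ↦ Subgroup.inclusion_injective hKA <|
        hA (Subgroup.inclusion hKA x) (Subgroup.inclusion hKA y) }
  have : Group.FG L.normalCore := L.normalCore.fg_of_index_ne_zero
  let e := N.equivMapOfInjective A.subtype A.subtype_injective
  let f := e.symm.toMonoidHom.comp (Subgroup.inclusion hKL)
  have hf : Function.Injective f := e.symm.injective.comp (Subgroup.inclusion_injective hKL)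
  have : IsMulTorsionFree L.normalCore := hf.isMulTorsionFree f
  exact ⟨L.normalCore, inferInstance, inferInstance,
    CommGroup.exists_mulEquiv_multiplicative_pi_int L.normalCore⟩
end

section
/- Let G be a group and let K be a normal subgroup of G of finite index which is free abelian of finite rank. Then there exists a positive-definite quadratic form Q : K → ℤ that is invariant under conjugation by G; that is: Q(x^n) = n²·Q(x) for all x ∈ K and n ∈ ℤ, the map (x, y) ↦ Q(xy) − Q(x) − Q(y) is biadditive on K, Q(x) > 0 for every x ≠ 1 in K, and Q(g x g⁻¹) = Q(x) for all g ∈ G and x ∈ K. -/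
/-- The action by conjugation of `G` on a commutative normal subgroup `K` factors through
`G ⧸ K`. -/
def quotientConj {G : Type*} [Group G] (K : Subgroup G) [K.Normal]
    (hcomm : ∀ x y : K, x * y = y * x) : G ⧸ K →* MulAut K :=
  QuotientGroup.lift K MulAut.conjNormal fun k hk => by
    ext x
    have h : k * (x : G) = x * k := congrArg Subtype.val (hcomm ⟨k, hk⟩ x)
    simp [MulAut.conjNormal_apply, h]

/-- The sum of squares of the coordinates of `x`, averaged over a finite group acting on `K`. -/
def averagedSumSq {H K ι : Type*} [Group H] [Fintype H] [Group K] [Fintype ι]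
    (φ : H →* MulAut K) (e : K ≃* Multiplicative (ι → ℤ)) (x : K) : ℤ :=
  ∑ c : H, ∑ i, ((e (φ c x)).toAdd i) ^ 2

section averagedSumSq

variable {H K ι : Type*} [Group H] [Fintype H] [Group K] [Fintype ι]
  (φ : H →* MulAut K) (e : K ≃* Multiplicative (ι → ℤ))

lemma averagedSumSq_zpow (x : K) (n : ℤ) :
    averagedSumSq φ e (x ^ n) = n ^ 2 * averagedSumSq φ e x := by
  simp [averagedSumSq, Finset.mul_sum, mul_pow]

lemma averagedSumSq_polar (x y : K) :
    averagedSumSq φ e (x * y) - averagedSumSq φ e x - averagedSumSq φ e y =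
      ∑ c : H, ∑ i, 2 * (e (φ c x)).toAdd i * (e (φ c y)).toAdd i := by
  simp only [averagedSumSq, ← Finset.sum_sub_distrib]
  refine Finset.sum_congr rfl fun c _ => Finset.sum_congr rfl fun i _ => ?_
  simp only [map_mul, toAdd_mul, Pi.add_apply]
  ring

lemma averagedSumSq_pos {x : K} (hx : x ≠ 1) : 0 < averagedSumSq φ e x := by
  have hnonneg (c : H) : 0 ≤ ∑ i, ((e (φ c x)).toAdd i) ^ 2 :=
    Finset.sum_nonneg fun i _ => sq_nonneg _
  refine Finset.sum_pos' (fun c _ => hnonneg c) ⟨1, Finset.mem_univ _, ?_⟩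
  have hne : (e x).toAdd ≠ 0 := by simpa using hx
  obtain ⟨i, hi⟩ := Function.ne_iff.mp hne
  refine Finset.sum_pos' (fun i _ => sq_nonneg _) ⟨i, Finset.mem_univ _, ?_⟩
  simpa using pow_pos (abs_pos.mpr hi) 2

lemma averagedSumSq_apply (h : H) (x : K) :
    averagedSumSq φ e (φ h x) = averagedSumSq φ e x := by
  simp only [averagedSumSq, ← MulAut.mul_apply, ← map_mul]
  exact Equiv.sum_comp (Equiv.mulRight h) fun c => ∑ i, ((e (φ c x)).toAdd i) ^ 2

end averagedSumSq


/-- If `K` is a finite-index normal subgroup of `G` which is free abelian of finite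
rank, then there is a positive-definite `ℤ`-valued quadratic form `Q` on `K` which is
invariant under conjugation by `G`. -/
theorem exists_conjugation_invariant_quadratic_form
    (G : Type*) [Group G] (K : Subgroup G) [hN : K.Normal] (hidx : K.FiniteIndex)
    (hfree : ∃ k : ℕ, Nonempty (K ≃* Multiplicative (Fin k → ℤ))) :
    ∃ Q : K → ℤ,
      (∀ (x : K) (n : ℤ), Q (x ^ n) = n ^ 2 * Q x) ∧
      (∀ x₁ x₂ y : K,
        Q (x₁ * x₂ * y) - Q (x₁ * x₂) - Q y
          = (Q (x₁ * y) - Q x₁ - Q y) + (Q (x₂ * y) - Q x₂ - Q y)) ∧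
      (∀ x y₁ y₂ : K,
        Q (x * (y₁ * y₂)) - Q x - Q (y₁ * y₂)
          = (Q (x * y₁) - Q x - Q y₁) + (Q (x * y₂) - Q x - Q y₂)) ∧
      (∀ x : K, x ≠ 1 → 0 < Q x) ∧
      (∀ (g : G) (x : K), Q ⟨g * (x : G) * g⁻¹, hN.conj_mem (x : G) x.2 g⟩ = Q x) := by
  obtain ⟨k, ⟨e⟩⟩ := hfree
  have hcomm (x y : K) : x * y = y * x := e.injective (by simp [mul_comm])
  have := Fintype.ofFinite (G ⧸ K)
  refine ⟨averagedSumSq (quotientConj K hcomm) e, averagedSumSq_zpow _ e, fun x₁ x₂ y => ?_,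
    fun x y₁ y₂ => ?_, fun x => averagedSumSq_pos _ e,
    fun g x => averagedSumSq_apply (quotientConj K hcomm) e (g : G ⧸ K) x⟩
  · simp only [averagedSumSq_polar, map_mul, toAdd_mul, Pi.add_apply, mul_add, add_mul,
      Finset.sum_add_distrib]
  · simp only [averagedSumSq_polar, map_mul, toAdd_mul, Pi.add_apply, mul_add,
      Finset.sum_add_distrib]
end

section
/- Let G be an abelian group, and let Γ = G ⋊ ℤ/2 be the semidirect product in which the generator a of ℤ/2 acts on G by inversion, so that a² = 1 and a·x·a = x⁻¹ for all x ∈ G. Let H be a subgroup of G, let X be a set, let f₀ : G → X satisfy f₀(x) = f₀(y) ⇔ x⁻¹y ∈ H, let s ∈ G, and define f₁ : G → X by f₁(x) = f₀(x·s⁻¹) and f : Γ → X by f(x) = f₀(x) and f(x·a) = f₁(x) for x ∈ G. Then the subset K = H ∪ (s·a)·H of Γ is a subgroup of Γ, and f hides K, i.e. for all u, v ∈ Γ one has f(u) = f(v) if and only if u⁻¹v ∈ K. -/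
/-- The action of `ℤ/2` (written multiplicatively) on an abelian group `G` in which the
generator acts by the inversion automorphism. -/
def invAction (G : Type*) [CommGroup G] : Multiplicative (ZMod 2) →* MulAut G where
  toFun z := if Multiplicative.toAdd z = 0 then 1 else (MulEquiv.inv G : MulAut G)
  map_one' := by simp
  map_mul' a b := by
    have h2 : (MulEquiv.inv G : MulAut G) * (MulEquiv.inv G : MulAut G) = 1 := by
      ext x
      simp [MulAut.mul_apply]
    have hz : ∀ z : ZMod 2, z = 0 ∨ z = 1 := by decide
    have h10 : (1 : ZMod 2) ≠ 0 := by decide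
    have h11 : (1 : ZMod 2) + 1 = 0 := by decide
    rcases hz (Multiplicative.toAdd a) with ha | ha <;>
      rcases hz (Multiplicative.toAdd b) with hb | hb <;>
      simp [toAdd_mul, ha, hb, h10, h11, h2]

/-- The level set through `1` of a function hiding `K` is `K`; so `K` is a subgroup. -/
lemma exists_subgroup_of_hides {Γ X : Type*} [Group Γ] {f : Γ → X} {K : Set Γ}
    (h : ∀ u v : Γ, f u = f v ↔ u⁻¹ * v ∈ K) : ∃ L : Subgroup Γ, (L : Set Γ) = K := by
  have h_one_left (v : Γ) : v ∈ K ↔ f 1 = f v := by simp [h]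
  have h_one_right (v : Γ) : v ∈ K ↔ f v⁻¹ = f 1 := by simp [h]
  refine ⟨{ carrier := K, mul_mem' := ?_, one_mem' := ?_, inv_mem' := ?_ }, rfl⟩
  · intro u v hu hv
    simpa using (h u⁻¹ v).1 (((h_one_right u).1 hu).trans ((h_one_left v).1 hv))
  · exact (h_one_left 1).2 rfl
  · intro u hu
    exact (h_one_left _).2 ((h_one_right u).1 hu).symm

namespace invAction

open SemidirectProduct

variable {G : Type*} [CommGroup G]

/-- The reflection generating the factor `ℤ/2` of `G ⋊ ℤ/2`. -/
def reflection (G : Type*) [CommGroup G] : G ⋊[invAction G] Multiplicative (ZMod 2) :=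
  inr (Multiplicative.ofAdd 1)

lemma reflection_mul_self : reflection G * reflection G = 1 := by
  rw [reflection, ← map_mul, ← ofAdd_add, show (1 : ZMod 2) + 1 = 0 by decide, ofAdd_zero,
    map_one]

lemma reflection_inv : (reflection G)⁻¹ = reflection G :=
  inv_eq_of_mul_eq_one_left reflection_mul_self

lemma reflection_mul_inl (x : G) :
    reflection G * inl x = inl x⁻¹ * reflection G := by
  ext
  · simp only [reflection, SemidirectProduct.mul_left, left_inl, left_inr, right_inl,
      right_inr, map_one, one_mul, mul_one]
    rfl
  · simp [reflection]

lemma inl_mul_reflection_inv (x : G) :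
    (inl x * reflection G)⁻¹ = inl x * reflection G := by
  rw [mul_inv_rev, reflection_inv, ← map_inv, reflection_mul_inl, inv_inv]

lemma eq_inl_or_eq_inl_mul_reflection (u : G ⋊[invAction G] Multiplicative (ZMod 2)) :
    (∃ x : G, u = inl x) ∨ ∃ x : G, u = inl x * reflection G := by
  obtain ⟨x, z⟩ := u
  have hz : ∀ z : Multiplicative (ZMod 2), z = 1 ∨ z = Multiplicative.ofAdd 1 := by decide
  rcases hz z with rfl | rfl
  · exact Or.inl ⟨x, rfl⟩
  · exact Or.inr ⟨x, by ext <;> simp [reflection]⟩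

lemma inl_ne_inl_mul_reflection (x y : G) :
    (inl x : G ⋊[invAction G] Multiplicative (ZMod 2)) ≠ inl y * reflection G := by
  intro h
  have h1 := congrArg SemidirectProduct.right h
  simp only [reflection, mul_right, right_inl, right_inr, one_mul] at h1
  exact absurd h1 (by decide)

/-- The set `H ∪ (s·a)·H`, where `a` is the reflection. -/
def shiftSet (H : Subgroup G) (s : G) : Set (G ⋊[invAction G] Multiplicative (ZMod 2)) :=
  (inl '' (H : Set G)) ∪ ((fun u => inl s * reflection G * u) '' (inl '' (H : Set G)))

lemma inl_mul_reflection_mul_inl (s h : G) :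
    inl s * reflection G * inl h = inl (s * h⁻¹) * reflection G := by
  rw [mul_assoc, reflection_mul_inl, ← mul_assoc, ← map_mul]

lemma inl_mem_shiftSet {H : Subgroup G} {s x : G} : inl x ∈ shiftSet H s ↔ x ∈ H := by
  constructor
  · rintro (⟨h, hh, e⟩ | ⟨_, ⟨h, hh, rfl⟩, e⟩)
    · rwa [← inl_injective e]
    · exact absurd (e.symm.trans (inl_mul_reflection_mul_inl s h))
        (inl_ne_inl_mul_reflection _ _)
  · exact fun hx => Or.inl ⟨x, hx, rfl⟩

lemma inl_mul_reflection_mem_shiftSet {H : Subgroup G} {s x : G} :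
    inl x * reflection G ∈ shiftSet H s ↔ x * s⁻¹ ∈ H := by
  constructor
  · rintro (⟨h, hh, e⟩ | ⟨_, ⟨h, hh, rfl⟩, e⟩)
    · exact absurd e (inl_ne_inl_mul_reflection _ _)
    · have hx := inl_injective (mul_right_cancel ((inl_mul_reflection_mul_inl s h).symm.trans e))
      rw [← hx, mul_inv_cancel_comm]
      exact H.inv_mem hh
  · intro hx
    refine Or.inr ⟨_, ⟨(x * s⁻¹)⁻¹, H.inv_mem hx, rfl⟩, ?_⟩
    exact (inl_mul_reflection_mul_inl s _).trans (by rw [inv_inv, mul_comm x, mul_inv_cancel_left])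

end invAction

open SemidirectProduct in
/-- **Reduction of the abelian hidden shift problem to a hidden subgroup problem.**
Let `G` be abelian and `Γ = G ⋊ ℤ/2` the semidirect product in which the generator `a`
of `ℤ/2` acts on `G` by inversion.  If `f₀ : G → X` hides the subgroup `H ≤ G`,
`f₁ x = f₀ (x * s⁻¹)` is its shift by `s`, and `f : Γ → X` is the joint function with
`f x = f₀ x` and `f (x * a) = f₁ x` for `x ∈ G`, then `K = H ∪ (s·a)·H` is a subgroup
of `Γ` and `f` hides `K`. -/
theorem hidden_shift_hides_subgroup
    (G : Type*) [CommGroup G] (X : Type*)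
    (H : Subgroup G) (f₀ : G → X)
    (hf₀ : ∀ x y : G, f₀ x = f₀ y ↔ x⁻¹ * y ∈ H)
    (s : G) (f₁ : G → X) (hf₁ : ∀ x : G, f₁ x = f₀ (x * s⁻¹))
    (a : G ⋊[invAction G] Multiplicative (ZMod 2))
    (ha : a = inr (Multiplicative.ofAdd (1 : ZMod 2)))
    (f : G ⋊[invAction G] Multiplicative (ZMod 2) → X)
    (hf : ∀ x : G, f (inl x) = f₀ x)
    (hfa : ∀ x : G, f (inl x * a) = f₁ x)
    (Kset : Set (G ⋊[invAction G] Multiplicative (ZMod 2)))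
    (hK : Kset = (inl '' (H : Set G)) ∪
        ((fun u => inl s * a * u) '' (inl '' (H : Set G)))) :
    (∃ K : Subgroup (G ⋊[invAction G] Multiplicative (ZMod 2)), (K : Set _) = Kset) ∧
    (∀ u v : G ⋊[invAction G] Multiplicative (ZMod 2),
        f u = f v ↔ u⁻¹ * v ∈ Kset) := by
  subst ha hK
  change (∃ K : Subgroup (G ⋊[invAction G] Multiplicative (ZMod 2)), (K : Set _) = invAction.shiftSet H s) ∧
    ∀ u v, f u = f v ↔ u⁻¹ * v ∈ invAction.shiftSet H s
  replace hfa (x : G) : f (inl x * invAction.reflection G) = f₀ (x * s⁻¹) :=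
    (hfa x).trans (hf₁ x)
  suffices h : ∀ u v, f u = f v ↔ u⁻¹ * v ∈ invAction.shiftSet H s from
    ⟨exists_subgroup_of_hides h, h⟩
  intro u v
  rcases invAction.eq_inl_or_eq_inl_mul_reflection u with ⟨x, rfl⟩ | ⟨x, rfl⟩ <;>
    rcases invAction.eq_inl_or_eq_inl_mul_reflection v with ⟨y, rfl⟩ | ⟨y, rfl⟩
  · rw [hf, hf, hf₀, ← map_inv, ← map_mul, invAction.inl_mem_shiftSet]
  · rw [hf, hfa, hf₀, ← mul_assoc, ← map_inv, ← mul_assoc (inl _), ← map_mul,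
      invAction.inl_mul_reflection_mem_shiftSet]
  · rw [hfa, hf, hf₀, invAction.inl_mul_reflection_inv, mul_assoc (inl x),
      invAction.reflection_mul_inl, ← mul_assoc (inl x), ← map_mul,
      invAction.inl_mul_reflection_mem_shiftSet, ← H.inv_mem_iff]
    simp [mul_comm, mul_left_comm]
  · rw [hfa, hfa, hf₀, invAction.inl_mul_reflection_inv, ← mul_assoc (inl x * _),
      invAction.inl_mul_reflection_mul_inl, mul_assoc (inl _), invAction.reflection_mul_self,
      mul_one, invAction.inl_mem_shiftSet, ← H.inv_mem_iff,
      mul_comm x s⁻¹, mul_comm y s⁻¹]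
    simp [mul_assoc, mul_comm x]
end

section
/- Let k ≥ 1 and let H ⊆ ℤ^k be a subgroup of rank ℓ ≥ 1 which is the ℤ-span of the columns of a k×ℓ integer matrix M of rank ℓ, with Gram determinant Δ = det(MᵀM). Then every nonzero vector y in the reciprocal lattice H° has Euclidean norm ‖y‖₂ ≥ 1/Δ. -/
/-- The lattice `H ⊆ ℤ^k ⊆ ℝ^k` generated over `ℤ` by the columns of the integer
matrix `M`, viewed inside Euclidean space `ℝ^k`. -/
def latticeSetE (k ℓ : ℕ) (M : Matrix (Fin k) (Fin ℓ) ℤ) :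
    Set (EuclideanSpace ℝ (Fin k)) :=
  {x | ∃ c : Fin ℓ → ℤ, x = fun i => ∑ j, (M i j : ℝ) * (c j : ℝ)}

/-- The reciprocal lattice `H° = {y ∈ H_ℝ : ⟨x, y⟩ ∈ ℤ for all x ∈ H}` of the lattice
generated by the columns of `M`, where `H_ℝ` is the real span of the lattice. -/
def reciprocalSetE (k ℓ : ℕ) (M : Matrix (Fin k) (Fin ℓ) ℤ) :
    Set (EuclideanSpace ℝ (Fin k)) :=
  {y | y ∈ Submodule.span ℝ (latticeSetE k ℓ M) ∧
    ∀ x ∈ latticeSetE k ℓ M, ∃ m : ℤ, ∑ i, x i * y i = (m : ℝ)}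

open Matrix in
/-- The real span of the lattice generated by the columns of `M` lies in the range of
multiplication by `M`. -/
theorem exists_mulVec_of_mem_span_latticeSetE {k ℓ : ℕ} {M : Matrix (Fin k) (Fin ℓ) ℤ}
    {y : EuclideanSpace ℝ (Fin k)} (hy : y ∈ Submodule.span ℝ (latticeSetE k ℓ M)) :
    ∃ a : Fin ℓ → ℝ, y.ofLp = M.map (Int.cast : ℤ → ℝ) *ᵥ a := by
  induction hy using Submodule.span_induction with
  | mem x hx =>
    obtain ⟨c, hc⟩ := hx
    exact ⟨fun j => c j, hc⟩
  | zero => exact ⟨0, by simp⟩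
  | add x z _ _ hx hz =>
    obtain ⟨a, ha⟩ := hx
    obtain ⟨b, hb⟩ := hz
    exact ⟨a + b, by rw [WithLp.ofLp_add, ha, hb, mulVec_add]⟩
  | smul t x _ hx =>
    obtain ⟨a, ha⟩ := hx
    exact ⟨t • a, by rw [WithLp.ofLp_smul, ha, mulVec_smul]⟩

open Matrix in
/-- Pairing a reciprocal lattice vector with the columns of `M` gives an integer vector. -/
theorem exists_transpose_mulVec_eq_of_mem_reciprocalSetE {k ℓ : ℕ}
    {M : Matrix (Fin k) (Fin ℓ) ℤ} {y : EuclideanSpace ℝ (Fin k)}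
    (hy : y ∈ reciprocalSetE k ℓ M) :
    ∃ m : Fin ℓ → ℤ, (M.map (Int.cast : ℤ → ℝ))ᵀ *ᵥ y.ofLp = fun j => (m j : ℝ) := by
  have h (j : Fin ℓ) : ∃ m : ℤ, ∑ i, (M i j : ℝ) * y i = m :=
    hy.2 (WithLp.toLp 2 fun i => (M i j : ℝ)) ⟨Pi.single j 1, by ext i; simp [Pi.single_apply]⟩
  choose m hm using h
  exact ⟨m, funext hm⟩

open Matrix in
/-- The Gram determinant multiplies the reciprocal lattice into `ℤ^k`. -/
theorem exists_det_mul_eq_intCast_of_mem_reciprocalSetE {k ℓ : ℕ}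
    {M : Matrix (Fin k) (Fin ℓ) ℤ} {y : EuclideanSpace ℝ (Fin k)}
    (hy : y ∈ reciprocalSetE k ℓ M) (i : Fin k) :
    ∃ z : ℤ, ((Mᵀ * M).det : ℝ) * y i = z := by
  obtain ⟨a, ha⟩ := exists_mulVec_of_mem_span_latticeSetE hy.1
  obtain ⟨m, hm⟩ := exists_transpose_mulVec_eq_of_mem_reciprocalSetE hy
  set R := M.map (Int.cast : ℤ → ℝ) with hR
  have hG : Rᵀ * R = (Mᵀ * M).map (Int.castRingHom ℝ) := by
    rw [Matrix.map_mul]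
    rfl
  have hadj : (Rᵀ * R).adjugate = (Mᵀ * M).adjugate.map (Int.castRingHom ℝ) := by
    rw [hG]
    exact ((Int.castRingHom ℝ).map_adjugate _).symm
  have hdet : (Rᵀ * R).det = ((Mᵀ * M).det : ℝ) := by
    rw [hG]
    exact ((Int.castRingHom ℝ).map_det _).symm
  have key : ((Mᵀ * M).det : ℝ) • y.ofLp = R *ᵥ ((Rᵀ * R).adjugate *ᵥ fun j => (m j : ℝ)) := by
    rw [← hm, ha, mulVec_mulVec a Rᵀ R, mulVec_mulVec a _ (Rᵀ * R), adjugate_mul, hdet, smul_mulVec,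
      one_mulVec, mulVec_smul]
  refine ⟨(M *ᵥ ((Mᵀ * M).adjugate *ᵥ m)) i, ?_⟩
  have := congrFun key i
  rw [hadj] at this
  simpa [mulVec, dotProduct, hR] using this


/-- **Minimum length in the reciprocal lattice.**  If `H ⊆ ℤ^k` is the lattice generated
by the columns of a `k×ℓ` integer matrix `M` of rank `ℓ ≥ 1`, with Gram determinant
`Δ = det (Mᵀ M)`, then every nonzero vector `y` of the reciprocal lattice `H°` has
Euclidean norm `‖y‖₂ ≥ 1/Δ`. -/
theorem reciprocal_lattice_min_euclidean_norm
    (k ℓ : ℕ) (hk : 1 ≤ k) (hℓ : 1 ≤ ℓ)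
    (M : Matrix (Fin k) (Fin ℓ) ℤ)
    (hrank : (M.map (Int.cast : ℤ → ℝ)).rank = ℓ)
    (Δ : ℤ) (hΔ : Δ = (M.transpose * M).det) :
    ∀ y ∈ reciprocalSetE k ℓ M, y ≠ 0 → 1 / (Δ : ℝ) ≤ ‖y‖ := by
  intro y hy hy0
  rcases le_or_gt Δ 0 with hneg | hpos
  · exact (one_div_nonpos.mpr (by exact_mod_cast hneg)).trans (norm_nonneg y)
  have hposR : (0 : ℝ) < Δ := by exact_mod_cast hpos
  obtain ⟨i, hi⟩ : ∃ i, y i ≠ 0 := by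
    by_contra! h
    exact hy0 (by ext i; simp [h i])
  obtain ⟨z, hz⟩ := exists_det_mul_eq_intCast_of_mem_reciprocalSetE hy i
  rw [← hΔ] at hz
  have hz0 : z ≠ 0 := by
    rintro rfl
    exact mul_ne_zero hposR.ne' hi (by simpa using hz)
  have hz1 : (1 : ℝ) ≤ |(z : ℝ)| := by exact_mod_cast Int.one_le_abs hz0
  rw [← hz, abs_mul, abs_of_pos hposR] at hz1
  have hle : |y i| ≤ ‖y‖ := PiLp.norm_apply_le y i
  rw [div_le_iff₀' hposR]
  exact hz1.trans (by gcongr)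
end

section
/- For all real numbers S > 0 and y > 0, the series ∑_{z=0}^{∞} exp(−π S² (z + y)²) converges and satisfies ∑_{z=0}^{∞} exp(−π S² (z + y)²) < 2·exp(−π S² y²) / min(1, S²·y). -/
open Real

/-- The common ratio `exp (-2πt)` lies below `1 - min 1 t / 2`. -/
lemma exp_neg_two_pi_mul_lt {t : ℝ} (ht : 0 < t) :
    Real.exp (-(2 * π * t)) < 1 - min 1 t / 2 := by
  set m := min 1 t
  have hm0 : 0 < m := lt_min one_pos ht
  have hm1 : m ≤ 1 := min_le_left _ _
  have hmt : m ≤ t := min_le_right _ _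
  have hx : 6 * m ≤ 2 * π * t := by nlinarith [Real.pi_gt_three]
  have h1 : 1 + 6 * m ≤ Real.exp (2 * π * t) := by
    linarith [Real.add_one_le_exp (2 * π * t)]
  rw [Real.exp_neg, inv_lt_iff_one_lt_mul₀ (Real.exp_pos _)]
  nlinarith

/-- Each Gaussian term is dominated by the corresponding term of a geometric sequence. -/
lemma exp_neg_sq_le_geometric (S y : ℝ) (z : ℕ) :
    Real.exp (-π * S ^ 2 * ((z : ℝ) + y) ^ 2) ≤
      Real.exp (-π * S ^ 2 * y ^ 2) * Real.exp (-(2 * π * (S ^ 2 * y))) ^ z := by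
  rw [← Real.exp_nat_mul, ← Real.exp_add, Real.exp_le_exp]
  have : 0 ≤ π * S ^ 2 * (z : ℝ) ^ 2 := by positivity
  nlinarith

/-- **One-dimensional Gaussian tail estimate.**  For all real `S > 0` and `y > 0`, the
series `∑_{z ≥ 0} exp(−π S² (z + y)²)` converges and is bounded by
`2·exp(−π S² y²) / min(1, S²·y)`. -/
theorem gaussian_geometric_tail_bound (S y : ℝ) (hS : 0 < S) (hy : 0 < y) :
    Summable (fun z : ℕ => Real.exp (-π * S ^ 2 * ((z : ℝ) + y) ^ 2)) ∧
    ∑' z : ℕ, Real.exp (-π * S ^ 2 * ((z : ℝ) + y) ^ 2)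
      < 2 * Real.exp (-π * S ^ 2 * y ^ 2) / min 1 (S ^ 2 * y) := by
  have ht : 0 < S ^ 2 * y := by positivity
  have hm : 0 < min 1 (S ^ 2 * y) := lt_min one_pos ht
  have hr := exp_neg_two_pi_mul_lt ht
  have hgeom := (hasSum_geometric_of_lt_one (Real.exp_pos _).le
    (by linarith : Real.exp (-(2 * π * (S ^ 2 * y))) < 1)).mul_left
      (Real.exp (-π * S ^ 2 * y ^ 2))
  have hsum : Summable (fun z : ℕ => Real.exp (-π * S ^ 2 * ((z : ℝ) + y) ^ 2)) :=
    hgeom.summable.of_nonneg_of_le (fun _ => (Real.exp_pos _).le) (exp_neg_sq_le_geometric S y)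
  refine ⟨hsum, (hasSum_le (exp_neg_sq_le_geometric S y) hsum.hasSum hgeom).trans_lt ?_⟩
  rw [← div_eq_mul_inv, div_lt_div_iff₀ (by linarith) hm]
  nlinarith [Real.exp_pos (-π * S ^ 2 * y ^ 2)]
end

section
/- There exist constants c > 0 and C ≥ 0 such that for all integers k and S with 1 ≤ k ≤ S, the discrete Gaussian sum satisfies |∑_{x ∈ ℤ^k} exp(−π ‖x‖₂² / S²) − S^k| ≤ C·exp(−c·S²). -/
open Real

/-- A product of nonnegative convergent series is the series of products over `Fin k → α`. -/
theorem hasSum_fin_prod_of_nonneg {α : Type*} {f : α → ℝ} {a : ℝ} (hf : ∀ x, 0 ≤ f x)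
    (h : HasSum f a) (k : ℕ) : HasSum (fun x : Fin k → α => ∏ i, f (x i)) (a ^ k) := by
  induction k with
  | zero => simp
  | succ k ih =>
    rw [← (Fin.consEquiv fun _ : Fin (k + 1) => α).hasSum_iff, pow_succ']
    have hs := h.summable.mul_of_nonneg ih.summable hf
      fun x => Finset.prod_nonneg fun i _ => hf (x i)
    refine (h.mul ih hs).congr_fun ?_
    intro x
    simp [Fin.consEquiv, Fin.prod_univ_succ]

theorem summable_exp_neg_mul_int_sq {a : ℝ} (ha : 0 < a) :
    Summable fun n : ℤ => exp (-π * a * (n : ℝ) ^ 2) := by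
  refine (summable_pow_mul_jacobiTheta₂_term_bound 0 ha 0).congr fun n => ?_
  simp [mul_assoc]

/-- The one-dimensional Gaussian sum at large scale is exponentially close to `1`. -/
theorem abs_tsum_exp_neg_mul_int_sq_sub_one_le {a : ℝ} (ha : 0 < a) :
    |(∑' n : ℤ, exp (-π * a * (n : ℝ) ^ 2)) - 1| ≤
      2 / (1 - exp (-π * a)) * exp (-π * a) := by
  have h := norm_jacobiTheta_sub_one_le (τ := Complex.I * a) (by simpa using ha)
  have e : jacobiTheta (Complex.I * a) = ((∑' n : ℤ, exp (-π * a * (n : ℝ) ^ 2) : ℝ) : ℂ) := by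
    rw [jacobiTheta, Complex.ofReal_tsum]
    refine tsum_congr fun n => ?_
    push_cast
    congr 1
    linear_combination (π * a * n ^ 2 : ℂ) * Complex.I_sq
  rw [e, ← Complex.ofReal_one, ← Complex.ofReal_sub, Complex.norm_real, Real.norm_eq_abs] at h
  simpa using h

theorem tsum_exp_neg_div_sq_pi (k : ℕ) {s : ℝ} (hs : 0 < s) :
    (∑' x : Fin k → ℤ, exp (-π * (∑ i, (x i : ℝ) ^ 2) / s ^ 2)) =
      (s * ∑' n : ℤ, exp (-π * s ^ 2 * (n : ℝ) ^ 2)) ^ k := by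
  have hpos : 0 < (s ^ 2)⁻¹ := by positivity
  have h := hasSum_fin_prod_of_nonneg (fun _ => (exp_pos _).le)
    (summable_exp_neg_mul_int_sq hpos).hasSum k
  rw [tsum_exp_neg_mul_int_sq hpos] at h
  have hscale : (1 : ℝ) / (s ^ 2)⁻¹ ^ (1 / 2 : ℝ) = s := by
    rw [← sqrt_eq_rpow, sqrt_inv, sqrt_sq hs.le, one_div, inv_inv]
  rw [hscale, div_inv_eq_mul] at h
  rw [← h.tsum_eq]
  refine tsum_congr fun x => ?_
  rw [← exp_sum, ← Finset.mul_sum]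
  congr 1
  ring

theorem two_div_one_sub_exp_mul_exp_le {a : ℝ} (ha : 1 ≤ a) :
    2 / (1 - exp (-π * a)) * exp (-π * a) ≤ 4 * exp (-3 * a) := by
  have hle : exp (-π * a) ≤ exp (-3 * a) := by
    gcongr
    linarith [pi_gt_three]
  have hhalf : exp (-3 * a) ≤ 1 / 2 := by
    rw [show -3 * a = -(3 * a) by ring, exp_neg, one_div]
    gcongr
    linarith [add_one_le_exp (3 * a)]
  refine mul_le_mul ?_ hle (exp_pos _).le (by norm_num)
  rw [div_le_iff₀ (by linarith)]
  linarith

theorem abs_pow_sub_one_le_mul_exp {x B : ℝ} (h : |x - 1| ≤ B) (k : ℕ) :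
    |x ^ k - 1| ≤ B * k * exp (k * B) := by
  have hB : 0 ≤ B := (abs_nonneg _).trans h
  have hmax : max |x| |1| ≤ 1 + B := by
    rw [abs_one]
    refine max_le ?_ (by linarith)
    calc |x| = |1 + (x - 1)| := by ring_nf
      _ ≤ |1| + |x - 1| := abs_add_le _ _
      _ ≤ 1 + B := by rw [abs_one]; linarith
  calc |x ^ k - 1| ≤ |x - 1| * k * max |x| |1| ^ (k - 1) := by
        simpa using abs_pow_sub_pow_le x 1 k
    _ ≤ B * k * (1 + B) ^ (k - 1) := by gcongr
    _ ≤ B * k * (1 + B) ^ k := by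
        gcongr
        · linarith
        · omega
    _ ≤ B * k * exp B ^ k := by
        gcongr
        linarith [add_one_le_exp B]
    _ = B * k * exp (k * B) := by rw [exp_nat_mul]

theorem pow_le_exp_mul_sub_one {k S : ℕ} (hS : 1 ≤ S) (hk : k ≤ S) :
    (S : ℝ) ^ k ≤ exp (S * (S - 1)) := by
  rw [exp_nat_mul]
  calc (S : ℝ) ^ k ≤ (S : ℝ) ^ S := by
        gcongr
        exact_mod_cast hS
    _ ≤ exp (S - 1) ^ S := by
        gcongr
        linarith [add_one_le_exp ((S : ℝ) - 1)]

/-- **Normalization of the discrete Gaussian.**  There are constants `c > 0` and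
`C ≥ 0` such that for all integers `1 ≤ k ≤ S`, the discrete Gaussian sum over `ℤ^k`
satisfies `|∑_{x ∈ ℤ^k} exp(−π ‖x‖₂²/S²) − S^k| ≤ C·exp(−c S²)`. -/
theorem discrete_gaussian_sum_estimate :
    ∃ c C : ℝ, 0 < c ∧ 0 ≤ C ∧
      ∀ k S : ℕ, 1 ≤ k → k ≤ S →
        |(∑' x : Fin k → ℤ,
            Real.exp (-π * (∑ i, ((x i : ℝ)) ^ 2) / (S : ℝ) ^ 2)) - (S : ℝ) ^ k|
          ≤ C * Real.exp (-c * (S : ℝ) ^ 2) := by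
  refine ⟨2, 4 * exp 4, by norm_num, by positivity, fun k S hk hkS => ?_⟩
  have hS : (1 : ℝ) ≤ S := by exact_mod_cast hk.trans hkS
  have hkS' : (k : ℝ) ≤ S := by exact_mod_cast hkS
  have hkexp : (k : ℝ) ≤ exp S := by linarith [add_one_le_exp (S : ℝ)]
  rw [tsum_exp_neg_div_sq_pi k (by linarith : (0 : ℝ) < S), mul_pow]
  set θ := ∑' n : ℤ, exp (-π * (S : ℝ) ^ 2 * (n : ℝ) ^ 2)
  have hθ : |θ - 1| ≤ 4 * exp (-3 * (S : ℝ) ^ 2) :=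
    (abs_tsum_exp_neg_mul_int_sq_sub_one_le (by positivity)).trans
      (two_div_one_sub_exp_mul_exp_le (one_le_pow₀ hS))
  have hexp : k * (4 * exp (-3 * (S : ℝ) ^ 2)) ≤ 4 := by
    calc k * (4 * exp (-3 * (S : ℝ) ^ 2))
        ≤ exp S * (4 * exp (-3 * (S : ℝ) ^ 2)) := by gcongr
      _ = 4 * exp (S + -3 * (S : ℝ) ^ 2) := by rw [exp_add]; ring
      _ ≤ 4 * 1 := by
          gcongr
          rw [exp_le_one_iff]
          nlinarith
      _ = 4 := mul_one 4
  calc |(S : ℝ) ^ k * θ ^ k - (S : ℝ) ^ k| = (S : ℝ) ^ k * |θ ^ k - 1| := by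
        rw [← mul_sub_one, abs_mul, abs_of_nonneg (by positivity : (0 : ℝ) ≤ (S : ℝ) ^ k)]
    _ ≤ exp (S * (S - 1)) * (4 * exp (-3 * (S : ℝ) ^ 2) * exp S * exp 4) := by
        refine mul_le_mul (pow_le_exp_mul_sub_one (hk.trans hkS) hkS) ?_ (abs_nonneg _)
          (exp_pos _).le
        refine (abs_pow_sub_one_le_mul_exp hθ k).trans ?_
        gcongr
    _ = 4 * exp 4 * (exp (S * (S - 1)) * exp (-3 * (S : ℝ) ^ 2) * exp S) := by ring
    _ = 4 * exp 4 * exp (-2 * (S : ℝ) ^ 2) := by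
        rw [← exp_add, ← exp_add]
        ring_nf
end

section
/- There exist constants c > 0 and C ≥ 0 such that for all integers k, S, Q with 1 ≤ k ≤ S and Q ≥ S², the truncated discrete Gaussian tail satisfies ∑_{x ∈ ℤ^k, ‖x‖_∞ ≥ Q/2} exp(−π ‖x‖₂² / S²) ≤ C·exp(−c·S²). -/
open Real

theorem summable_one_div_one_add_int_sq : Summable fun n : ℤ => 1 / (1 + (n : ℝ) ^ 2) := by
  refine Summable.of_norm_bounded_eventually
    (Real.summable_one_div_int_pow.mpr (by norm_num : 1 < 2)) ?_
  filter_upwards [(Set.finite_singleton (0 : ℤ)).compl_mem_cofinite] with n hn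
  have hn' : (n : ℝ) ≠ 0 := by simpa using hn
  rw [Real.norm_of_nonneg (by positivity)]
  exact one_div_le_one_div_of_le (by positivity) (by linarith)

/-- A Gaussian of width `s ≥ 1` is dominated by a summable rational function. -/
theorem exp_neg_pi_mul_div_le {s t : ℝ} (hs : 1 ≤ s) (ht : 0 ≤ t) :
    Real.exp (-(π * t / (2 * s))) ≤ s * (1 / (1 + t)) := by
  have h : t / s ≤ π * t / (2 * s) := by
    rw [div_le_div_iff₀ (by positivity) (by positivity)]
    nlinarith [Real.two_le_pi, mul_nonneg ht (by positivity : 0 ≤ s)]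
  have h' := Real.add_one_le_exp (π * t / (2 * s))
  rw [Real.exp_neg, mul_one_div, inv_le_comm₀ (Real.exp_pos _) (by positivity), inv_div]
  refine le_trans ?_ h'
  have h1 : (1 + t) / s = 1 / s + t / s := add_div _ _ _
  have h2 : 1 / s ≤ 1 := (div_le_one (by positivity)).mpr hs
  linarith

/-- A sum of products over distinct vectors is at most the power of the one-dimensional sum. -/
theorem sum_prod_le_tsum_pow {ι α : Type*} [Fintype ι] [DecidableEq ι] [DecidableEq α]
    {f : α → ℝ} (hf : Summable f) (hf0 : ∀ a, 0 ≤ f a) (s : Finset (ι → α)) :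
    ∑ x ∈ s, ∏ i, f (x i) ≤ (∑' a, f a) ^ Fintype.card ι := by
  calc ∑ x ∈ s, ∏ i, f (x i)
      ≤ ∑ x ∈ Fintype.piFinset fun i => s.image fun x => x i, ∏ i, f (x i) := by
        refine Finset.sum_le_sum_of_subset_of_nonneg (fun x hx => ?_)
          fun x _ _ => Finset.prod_nonneg fun i _ => hf0 _
        exact Fintype.mem_piFinset.mpr fun i => Finset.mem_image_of_mem (fun x => x i) hx
    _ = ∏ i, ∑ a ∈ s.image fun x => x i, f a := (Finset.prod_univ_sum _ _).symm
    _ ≤ ∏ _i : ι, ∑' a, f a :=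
        Finset.prod_le_prod (fun i _ => Finset.sum_nonneg fun a _ => hf0 a)
          fun i _ => hf.sum_le_tsum _ fun a _ => hf0 a
    _ = _ := by simp

theorem exists_pow_le_mul_exp_sq (A : ℝ) (hA : 0 ≤ A) {ε : ℝ} (hε : 0 < ε) :
    ∃ C, 0 ≤ C ∧ ∀ n : ℕ, ((n : ℝ) ^ 2 * A) ^ n ≤ C * Real.exp (ε * (n : ℝ) ^ 2) := by
  have hlim : Filter.Tendsto (fun n : ℕ => A * ((n : ℝ) ^ (2 : ℝ) * Real.exp (-ε * n)))
      Filter.atTop (nhds (A * 0)) :=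
    ((tendsto_rpow_mul_exp_neg_mul_atTop_nhds_zero 2 ε hε).comp
      tendsto_natCast_atTop_atTop).const_mul A
  rw [mul_zero] at hlim
  obtain ⟨N, hN⟩ := Filter.eventually_atTop.mp (hlim.eventually_le_const one_pos)
  refine ⟨1 + ∑ m ∈ Finset.range N, ((m : ℝ) ^ 2 * A) ^ m, by positivity, fun n => ?_⟩
  have h1 : 1 ≤ Real.exp (ε * (n : ℝ) ^ 2) := Real.one_le_exp (by positivity)
  have h0 : 0 ≤ ∑ m ∈ Finset.range N, ((m : ℝ) ^ 2 * A) ^ m := by positivity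
  rcases lt_or_ge n N with h | h
  · have := Finset.single_le_sum (f := fun m : ℕ => ((m : ℝ) ^ 2 * A) ^ m)
      (fun m _ => by positivity) (Finset.mem_range.mpr h)
    nlinarith
  · have hb : (n : ℝ) ^ 2 * A ≤ Real.exp (ε * n) := by
      have := hN n h
      rw [Real.rpow_two, neg_mul, Real.exp_neg, ← mul_assoc, ← div_eq_mul_inv,
        div_le_one (Real.exp_pos _)] at this
      linarith
    calc ((n : ℝ) ^ 2 * A) ^ n ≤ Real.exp (ε * n) ^ n := by gcongr
      _ = Real.exp (ε * (n : ℝ) ^ 2) := by rw [← Real.exp_nat_mul]; congr 1; ring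
      _ ≤ _ := by nlinarith

/-- **Tail of the discrete Gaussian outside a cube.**  There are constants `c > 0` and
`C ≥ 0` such that for all integers `1 ≤ k ≤ S` and `Q ≥ S²`, the discrete Gaussian sum
over the integer vectors `x ∈ ℤ^k` with `‖x‖_∞ ≥ Q/2` satisfies
`∑ exp(−π ‖x‖₂²/S²) ≤ C·exp(−c S²)`. -/
theorem discrete_gaussian_cube_tail_estimate :
    ∃ c C : ℝ, 0 < c ∧ 0 ≤ C ∧
      ∀ k S Q : ℕ, 1 ≤ k → k ≤ S → S ^ 2 ≤ Q →
        (∑' x : {x : Fin k → ℤ // ∃ i, (Q : ℝ) / 2 ≤ |(x i : ℝ)|},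
            Real.exp (-π * (∑ i, (((x : Fin k → ℤ) i : ℝ)) ^ 2) / (S : ℝ) ^ 2))
          ≤ C * Real.exp (-c * (S : ℝ) ^ 2) := by
  set A : ℝ := ∑' n : ℤ, 1 / (1 + (n : ℝ) ^ 2) with hA
  have hA1 : 1 ≤ A := by
    simpa [hA] using summable_one_div_one_add_int_sq.le_tsum 0 fun n _ => by positivity
  obtain ⟨C, hC0, hC⟩ := exists_pow_le_mul_exp_sq A (by linarith) (ε := π / 16) (by positivity)
  refine ⟨π / 16, C, by positivity, hC0, fun k S Q hk hkS hSQ => ?_⟩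
  have hS1 : (1 : ℝ) ≤ S := by exact_mod_cast hk.trans hkS
  have hS2 : (1 : ℝ) ≤ (S : ℝ) ^ 2 := one_le_pow₀ hS1
  have hQ : (S : ℝ) ^ 2 ≤ Q := by exact_mod_cast hSQ
  set f : ℤ → ℝ := fun n => (S : ℝ) ^ 2 * (1 / (1 + (n : ℝ) ^ 2))
  have hf0 : ∀ n, 0 ≤ f n := fun n => by positivity
  have hfs : Summable f := summable_one_div_one_add_int_sq.mul_left _
  have hft : ∑' n, f n = (S : ℝ) ^ 2 * A := tsum_mul_left
  have hterm : ∀ x : {x : Fin k → ℤ // ∃ i, (Q : ℝ) / 2 ≤ |(x i : ℝ)|},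
      Real.exp (-π * (∑ i, (((x : Fin k → ℤ) i : ℝ)) ^ 2) / (S : ℝ) ^ 2) ≤
        Real.exp (-(π / 8) * (S : ℝ) ^ 2) * ∏ i, f (x.1 i) := by
    rintro ⟨x, i, hi⟩
    have hxi : ((S : ℝ) ^ 2 / 2) ^ 2 ≤ ∑ j, (x j : ℝ) ^ 2 := by
      calc ((S : ℝ) ^ 2 / 2) ^ 2 ≤ |(x i : ℝ)| ^ 2 := by gcongr; linarith
        _ = (x i : ℝ) ^ 2 := sq_abs _
        _ ≤ _ := Finset.single_le_sum (f := fun j => (x j : ℝ) ^ 2)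
          (fun j _ => sq_nonneg _) (Finset.mem_univ i)
    calc Real.exp (-π * (∑ j, (x j : ℝ) ^ 2) / (S : ℝ) ^ 2)
        ≤ Real.exp (-(π / 8) * (S : ℝ) ^ 2 + ∑ j, -(π * (x j : ℝ) ^ 2 / (2 * (S : ℝ) ^ 2))) := by
          rw [Real.exp_le_exp, Finset.sum_neg_distrib, ← Finset.sum_div, ← Finset.mul_sum,
            ← sub_nonneg]
          have : -(π / 8) * (S : ℝ) ^ 2 + -(π * (∑ j, (x j : ℝ) ^ 2) / (2 * (S : ℝ) ^ 2)) -
              -π * (∑ j, (x j : ℝ) ^ 2) / (S : ℝ) ^ 2 =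
              π / (2 * (S : ℝ) ^ 2) * ((∑ j, (x j : ℝ) ^ 2) - ((S : ℝ) ^ 2 / 2) ^ 2) := by
            field_simp
            ring
          rw [this]
          exact mul_nonneg (by positivity) (sub_nonneg.mpr hxi)
      _ ≤ _ := by
          rw [Real.exp_add, Real.exp_sum]
          gcongr with j
          exact exp_neg_pi_mul_div_le hS2 (sq_nonneg _)
  have hpow : ((S : ℝ) ^ 2 * A) ^ k ≤ C * Real.exp (π / 16 * (S : ℝ) ^ 2) :=
    (pow_le_pow_right₀ (one_le_mul_of_one_le_of_one_le hS2 hA1) hkS).trans (hC S)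
  refine Real.tsum_le_of_sum_le (fun x => (Real.exp_pos _).le) fun s => ?_
  have hsum : ∑ x ∈ s, ∏ i, f (x.1 i) ≤ ((S : ℝ) ^ 2 * A) ^ k := by
    have := sum_prod_le_tsum_pow hfs hf0 (s.map (Function.Embedding.subtype _))
    rwa [Finset.sum_map, hft, Fintype.card_fin] at this
  calc _ ≤ ∑ x ∈ s, Real.exp (-(π / 8) * (S : ℝ) ^ 2) * ∏ i, f (x.1 i) :=
        Finset.sum_le_sum fun x _ => hterm x
    _ = Real.exp (-(π / 8) * (S : ℝ) ^ 2) * ∑ x ∈ s, ∏ i, f (x.1 i) := by rw [Finset.mul_sum]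
    _ ≤ Real.exp (-(π / 8) * (S : ℝ) ^ 2) * (C * Real.exp (π / 16 * (S : ℝ) ^ 2)) := by
        gcongr
        exact hsum.trans hpow
    _ = C * Real.exp (-(π / 16) * (S : ℝ) ^ 2) := by
        rw [mul_left_comm, ← Real.exp_add]
        congr 2
        ring
end
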